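/- Let N > 0 and p, q > 1 be real numbers, and let s : ℕ → ℝ be a sequence with s(0) > N(pq - 1)/(2(p+1)). Then it cannot hold that for every n ∈ ℕ one has both Npq - 2(p+1)·s(n) > 0 and s(n+1) = N·s(n)/(Npq - 2(p+1)·s(n)). In other words, for any sequence satisfying this recursion while its denominators are positive, there exists n with Npq - 2(p+1)·s(n) ≤ 0. -/

import Mathlib

theorem bootstrap_terminates (N p q : ℝ) (hN : 0 < N) (hp : 1 < p) (hq : 1 < q)
    (s : ℕ → ℝ) (h0 : s 0 > N * (p * q - 1) / (2 * (p + 1))) :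
    ¬ (∀ n : ℕ, N * p * q - 2 * (p + 1) * s n > 0 ∧
        s (n + 1) = N * s n / (N * p * q - 2 * (p + 1) * s n)) := by
  intro h
  have hpq : 1 < p * q := one_lt_mul_of_lt_of_le hp hq.le
  -- The scaled excess over the fixed point grows at least geometrically with ratio `p * q`.
  obtain ⟨e, he⟩ : ∃ e : ℕ → ℝ, ∀ n, e n = 2 * (p + 1) * s n - N * (p * q - 1) :=
    ⟨_, fun _ => rfl⟩
  have he_lt (n : ℕ) : e n < N := by
    linarith [(h n).1, he n]
  have he0 : 0 < e 0 := by
    have := (div_lt_iff₀ (by linarith : 0 < 2 * (p + 1))).1 h0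
    linarith [he 0]
  have he_succ (n : ℕ) : e (n + 1) = N * (p * q) * e n / (N - e n) := by
    have hden : N * p * q - 2 * (p + 1) * s n = N - e n := by rw [he]; ring
    have hne : N - e n ≠ 0 := (sub_pos.2 (he_lt n)).ne'
    rw [he (n + 1), (h n).2, hden, eq_div_iff hne, sub_mul, mul_assoc (2 * (p + 1)), div_mul_cancel₀ _ hne, he n]
    ring
  have hgrow (n : ℕ) : (p * q) ^ n * e 0 ≤ e n := by
    induction n with
    | zero => simp
    | succ n ih =>
      have hen : 0 < e n := lt_of_lt_of_le (by positivity) ih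
      calc (p * q) ^ (n + 1) * e 0 = p * q * ((p * q) ^ n * e 0) := by ring
        _ ≤ p * q * e n := by gcongr
        _ ≤ e (n + 1) := by
          rw [he_succ, le_div_iff₀ (sub_pos.2 (he_lt n))]
          have : 0 ≤ p * q * e n * e n := by positivity
          linarith
  obtain ⟨n, hn⟩ := pow_unbounded_of_one_lt (N / e 0) hpq
  linarith [(div_lt_iff₀ he0).1 hn, hgrow n, he_lt n]
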